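/- For every integer n ≥ 0 there do not exist two continuous tangent vector fields v, w on the sphere S^{4n+1} ⊂ ℝ^{4n+2} that are linearly independent at every point: if v, w : S^{4n+1} → ℝ^{4n+2} are continuous with ⟨v(x), x⟩ = ⟨w(x), x⟩ = 0 for all x, then there exists a point x at which v(x) and w(x) are linearly dependent. (The special case of Adams' vector field theorem used in the paper's topological proof of Seifert's theorem on S^{4n+1}.) -/

import Mathlib

open scoped RealInnerProductSpace

section Cochains

variable {P : Type*}

/-- Delete the entry of index `l` from a sequence. -/
def skip (l : ℕ) (x : ℕ → P) : ℕ → P := fun i => if i < l then x i else x (i + 1)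

/-- The cup product of the coboundaries of `s 0, …, s (n - 1)`, evaluated on the ordered simplex
with vertices `x 0, …, x n`. -/
def cup (n : ℕ) (s : ℕ → P → ZMod 2) (x : ℕ → P) : ZMod 2 :=
  ∏ i ∈ Finset.range n, (s i (x i) + s i (x (i + 1)))

lemma cup_succ (n : ℕ) (s : ℕ → P → ZMod 2) (x : ℕ → P) :
    cup (n + 1) s x =
      (s 0 (x 0) + s 0 (x 1)) * cup n (fun i => s (i + 1)) (fun i => x (i + 1)) := by
  simp only [cup, Finset.prod_range_succ', zero_add]
  ring

lemma skip_zero (x : ℕ → P) : skip 0 x = fun i => x (i + 1) := by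
  funext i; simp [skip]

lemma skip_succ_zero (l : ℕ) (x : ℕ → P) : skip (l + 1) x 0 = x 0 := by
  simp [skip]

lemma skip_succ_succ (l : ℕ) (x : ℕ → P) (i : ℕ) :
    skip (l + 1) x (i + 1) = skip l (fun i => x (i + 1)) i := by
  simp [skip]

/-- A cup product of coboundaries is a cocycle. -/
lemma sum_cup_skip (n : ℕ) (s : ℕ → P → ZMod 2) (x : ℕ → P) :
    ∑ l ∈ Finset.range (n + 2), cup n s (skip l x) = 0 := by
  induction n generalizing s x with
  | zero =>
    simp [cup]
    decide
  | succ n ih =>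
    have ih' := ih (fun i => s (i + 1)) (fun i => x (i + 1))
    rw [Finset.sum_range_succ'] at ih' ⊢
    rw [Finset.sum_range_succ']
    simp only [cup_succ, skip_succ_zero, skip_succ_succ, skip_zero, zero_add]
    rw [← Finset.mul_sum]
    have e : ∑ i ∈ Finset.range (n + 1),
        cup n (fun i => s (i + 1)) (skip (i + 1) fun i => x (i + 1)) =
        cup n (fun i => s (i + 1)) (fun i => x (i + 1 + 1)) := by
      rw [skip_zero] at ih'
      exact CharTwo.add_eq_zero.mp ih'
    simp only [e, one_add_one_eq_two]
    generalize s 0 (x 0) = a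
    generalize s 0 (x 1) = b
    generalize s 0 (x _) = c
    generalize cup _ _ _ = q
    revert a b c q
    decide

/-- The coboundary of `a ∪ t ∪ b`, where `a` and `b` are products of coboundaries. -/
lemma sum_cup_skip_mul (n r : ℕ) (hr : r ≤ n) (s : ℕ → P → ZMod 2) (t : P → ZMod 2)
    (x : ℕ → P) :
    ∑ l ∈ Finset.range (n + 2), cup n (skip r s) (skip l x) * t (skip l x r) =
      cup (n + 1) (Function.update s r t) x := by
  induction r generalizing n s x with
  | zero =>
    have h := sum_cup_skip n (fun i => s (i + 1)) x
    rw [Finset.sum_range_succ'] at h ⊢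
    simp only [skip_succ_zero, skip_zero] at h ⊢
    rw [← Finset.sum_mul, CharTwo.add_eq_zero.mp h, cup_succ]
    simp only [Function.update_self, ne_eq, Nat.add_eq_zero_iff, one_ne_zero, and_false,
      not_false_eq_true, Function.update_of_ne, zero_add]
    ring
  | succ r ih =>
    obtain ⟨n, rfl⟩ : ∃ k, n = k + 1 := ⟨n - 1, by omega⟩
    have ih' := ih n (by omega) (fun i => s (i + 1)) (fun i => x (i + 1))
    rw [Finset.sum_range_succ'] at ih' ⊢
    rw [Finset.sum_range_succ']
    have e3 : (fun i => Function.update s (r + 1) t (i + 1)) =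
        Function.update (fun i => s (i + 1)) r t := by
      funext i
      by_cases hi : i = r <;> simp [hi]
    have e4 : Function.update s (r + 1) t 0 = s 0 := by simp
    rw [cup_succ (n + 1), e3, e4, ← ih']
    simp only [cup_succ n, skip_succ_zero, skip_succ_succ, skip_zero, zero_add]
    simp only [mul_add, Finset.mul_sum, mul_assoc, add_assoc]
    congr 1
    generalize s 0 (x 0) = a
    generalize s 0 (x 1) = b
    generalize s 0 (x _) = c
    generalize cup _ _ _ = q
    generalize t _ = y
    revert a b c q y
    decide

end Cochains

section Box

variable {ι : Type*} [Fintype ι] [DecidableEq ι] {N : ℕ}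

/-- The edges of the interval `[-m, m] ∩ ℤ`, each directed from its odd to its even end. -/
noncomputable def boxEdges (m : ℤ) : Finset (ℤ × ℤ) :=
  (Finset.Icc (-m) m ×ˢ Finset.Icc (-m) m).filter
    fun e => e.1 % 2 = 1 ∧ e.2 % 2 = 0 ∧ (e.2 = e.1 + 1 ∨ e.2 = e.1 - 1)

lemma mem_boxEdges {m : ℤ} {e : ℤ × ℤ} : e ∈ boxEdges m ↔
    (-m ≤ e.1 ∧ e.1 ≤ m) ∧ (-m ≤ e.2 ∧ e.2 ≤ m) ∧
      e.1 % 2 = 1 ∧ e.2 % 2 = 0 ∧ (e.2 = e.1 + 1 ∨ e.2 = e.1 - 1) := by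
  simp [boxEdges, and_assoc]

/-- The families of edges of the box `[-m, m] ^ ι`. -/
noncomputable def boxCells (ι : Type*) [Fintype ι] [DecidableEq ι] (m : ℤ) : Finset (ι → ℤ × ℤ) :=
  Fintype.piFinset fun _ => boxEdges m

lemma mem_boxCells {m : ℤ} {κ : ι → ℤ × ℤ} : κ ∈ boxCells ι m ↔ ∀ j, κ j ∈ boxEdges m := by
  simp [boxCells]

/-- The vertices of the simplex which moves from the odd to the even ends of the edges `κ`, one
coordinate at a time in the order prescribed by `σ`. -/
def vert (κ : ι → ℤ × ℤ) (σ : ι ≃ Fin N) (l : ℕ) : ι → ℤ :=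
  fun j => if (σ j : ℕ) < l then (κ j).2 else (κ j).1

/-- Change of sign of the coordinates in `B`. -/
def reflect (B : ι → Prop) [DecidablePred B] (x : ι → ℤ) : ι → ℤ :=
  fun j => if B j then -x j else x j

lemma sum_skip_inner (κ : ι → ℤ × ℤ) (F : (ℕ → ι → ℤ) → ZMod 2) {l : ℕ} (h0 : 0 < l)
    (hl : l < N) : ∑ σ : ι ≃ Fin N, F (skip l (vert κ σ)) = 0 := by
  set a : Fin N := ⟨l - 1, by omega⟩
  set b : Fin N := ⟨l, hl⟩
  have hab : a ≠ b := by simp [a, b, Fin.ext_iff]; omega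
  refine Finset.sum_involution (fun σ _ => σ.trans (Equiv.swap a b)) ?_ ?_ ?_ ?_
  · intro σ _
    have : skip l (vert κ (σ.trans (Equiv.swap a b))) = skip l (vert κ σ) := by
      have key : ∀ i, i ≠ l → vert κ (σ.trans (Equiv.swap a b)) i = vert κ σ i := by
        intro i hi
        funext j
        have : ((Equiv.swap a b (σ j) : Fin N) : ℕ) < i ↔ (σ j : ℕ) < i := by
          rw [Equiv.swap_apply_def]
          split_ifs with h1 h2
          · rw [h1]; simp only [a, b]; omega
          · rw [h2]; simp only [a, b]; omega
          · rfl
        simp [vert, this]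
      funext i
      simp only [skip]
      split_ifs with h
      · exact key i (by omega)
      · exact key _ (by omega)
    rw [this]
    exact CharTwo.add_self_eq_zero _
  · intro σ _ _ h
    have := congrArg (fun τ : ι ≃ Fin N => τ (σ.symm a)) h
    simp at this
    exact hab this.symm
  · intro σ _; exact Finset.mem_univ _
  · intro σ _; ext j; simp

lemma sum_skip_first {m : ℤ} (hm : m % 2 = 1) (σ : ι ≃ Fin N) (hN : 0 < N)
    (F : (ℕ → ι → ℤ) → ZMod 2) :
    ∑ κ ∈ boxCells ι m, F (skip 0 (vert κ σ)) = 0 := by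
  set j₀ := σ.symm ⟨0, hN⟩
  have hj : (σ j₀ : ℕ) = 0 := by simp [j₀]
  refine Finset.sum_involution
    (fun κ _ => Function.update κ j₀ (2 * (κ j₀).2 - (κ j₀).1, (κ j₀).2)) ?_ ?_ ?_ ?_
  · intro κ _
    have : skip 0 (vert (Function.update κ j₀ (2 * (κ j₀).2 - (κ j₀).1, (κ j₀).2)) σ) =
        skip 0 (vert κ σ) := by
      rw [skip_zero, skip_zero]
      funext i j
      by_cases h : j = j₀
      · subst h; simp [vert, hj]
      · simp [vert, h]
    rw [this]
    exact CharTwo.add_self_eq_zero _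
  · intro κ hκ _ h
    have h1 := congrArg (fun κ : ι → ℤ × ℤ => (κ j₀).1) h
    have h2 := mem_boxEdges.mp (mem_boxCells.mp hκ j₀)
    simp at h1
    omega
  · intro κ hκ
    rw [mem_boxCells] at hκ ⊢
    intro j
    by_cases h : j = j₀
    · subst h
      have h2 := mem_boxEdges.mp (hκ j₀)
      rw [mem_boxEdges]
      simp only [Function.update_self]
      omega
    · simpa [h] using hκ j
  · intro κ _
    simp

lemma sum_vert_last {m : ℤ} (hm : m % 2 = 1) (σ : ι ≃ Fin N) (j₀ : ι)
    (hj : (σ j₀ : ℕ) + 1 = N) (F : (ℕ → ι → ℤ) → ZMod 2)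
    (hF : ∀ x y, (∀ i < N, x i = y i) → F x = F y) (B : ι → Prop) [DecidablePred B]
    (hB : B j₀)
    (hbd : ∀ κ ∈ boxCells ι m, |(κ j₀).1| = m →
      F (vert κ σ) + F (fun i => reflect B (vert κ σ i)) = 0) :
    ∑ κ ∈ boxCells ι m, F (vert κ σ) = 0 := by
  refine Finset.sum_involution
    (fun κ _ => if |2 * (κ j₀).1 - (κ j₀).2| ≤ m
      then Function.update κ j₀ ((κ j₀).1, 2 * (κ j₀).1 - (κ j₀).2)
      else fun j => if B j then -κ j else κ j) ?_ ?_ ?_ ?_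
  · intro κ hκ
    have h2 := mem_boxEdges.mp (mem_boxCells.mp hκ j₀)
    split_ifs with h
    · have : F (vert (Function.update κ j₀ ((κ j₀).1, 2 * (κ j₀).1 - (κ j₀).2)) σ) =
          F (vert κ σ) := by
        apply hF
        intro i hi
        funext j
        by_cases h : j = j₀
        · subst h
          have : ¬ (σ j : ℕ) < i := by omega
          simp [vert, this]
        · simp [vert, h]
      rw [this]
      exact CharTwo.add_self_eq_zero _
    · have hm' : |(κ j₀).1| = m := by
        rw [abs_le] at h
        rcases abs_cases (κ j₀).1 with h | h <;> omega
      rw [← hbd κ hκ hm']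
      congr 2
      funext i j
      simp only [vert, reflect]
      split_ifs <;> simp
  · intro κ hκ _ h
    have h2 := mem_boxEdges.mp (mem_boxCells.mp hκ j₀)
    have h1 := congrArg (fun κ : ι → ℤ × ℤ => κ j₀) h
    split_ifs at h1 with h3
    · simp [Prod.ext_iff] at h1
      omega
    · simp [hB, Prod.ext_iff] at h1
      omega
  · intro κ hκ
    rw [mem_boxCells] at hκ ⊢
    intro j
    have h2 := mem_boxEdges.mp (hκ j)
    split_ifs with h
    · by_cases hjj : j = j₀
      · subst hjj
        rw [abs_le] at h
        rw [mem_boxEdges]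
        simp only [Function.update_self]
        omega
      · simpa [hjj] using hκ j
    · beta_reduce
      split_ifs
      · rw [mem_boxEdges]
        simp only [Prod.fst_neg, Prod.snd_neg]
        omega
      · exact hκ j
  · intro κ hκ
    have h2 := mem_boxEdges.mp (mem_boxCells.mp hκ j₀)
    have h3 : |(κ j₀).2| ≤ m := by rw [abs_le]; omega
    by_cases h : |2 * (κ j₀).1 - (κ j₀).2| ≤ m
    · simp [h, h3]
    · have h4 : ¬ |(κ j₀).2 - 2 * (κ j₀).1| ≤ m := by rwa [abs_sub_comm]
      simp only [if_neg h, hB, if_true, Prod.fst_neg, Prod.snd_neg, mul_neg, sub_neg_eq_add,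
        neg_add_eq_sub, if_neg h4]
      funext j
      split_ifs <;> simp

/-- Stokes' formula on a box whose boundary simplices are cancelled by reflections. -/
lemma sum_boundary_eq_zero {m : ℤ} (hm : m % 2 = 1) (hN : 0 < N) (F : (ℕ → ι → ℤ) → ZMod 2)
    (hF : ∀ x y, (∀ i < N, x i = y i) → F x = F y)
    (hbd : ∀ (σ : ι ≃ Fin N) (j₀ : ι), (σ j₀ : ℕ) + 1 = N →
      ∃ (B : ι → Prop) (_ : DecidablePred B), B j₀ ∧
        ∀ κ ∈ boxCells ι m, |(κ j₀).1| = m →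
          F (vert κ σ) + F (fun i => reflect B (vert κ σ i)) = 0) :
    ∑ κ ∈ boxCells ι m, ∑ σ : ι ≃ Fin N,
      ∑ l ∈ Finset.range (N + 1), F (skip l (vert κ σ)) = 0 := by
  have : ∀ κ ∈ boxCells ι m, ∑ σ : ι ≃ Fin N,
      ∑ l ∈ Finset.range (N + 1), F (skip l (vert κ σ)) =
      ∑ σ : ι ≃ Fin N, (F (skip 0 (vert κ σ)) + F (vert κ σ)) := by
    intro κ _
    obtain ⟨n, rfl⟩ : ∃ n, N = n + 1 := ⟨N - 1, by omega⟩
    rw [Finset.sum_comm, Finset.sum_range_succ, Finset.sum_range_succ', Finset.sum_eq_zero,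
      zero_add, Finset.sum_add_distrib]
    · congr 1
      refine Finset.sum_congr rfl fun σ _ => hF _ _ fun i hi => ?_
      simp [skip, hi]
    · intro l hl
      rw [Finset.mem_range] at hl
      exact sum_skip_inner κ F (by omega) (by omega)
  rw [Finset.sum_congr rfl this, Finset.sum_comm]
  refine Finset.sum_eq_zero fun σ _ => ?_
  rw [Finset.sum_add_distrib, sum_skip_first hm σ hN, zero_add]
  set j₀ := σ.symm ⟨N - 1, by omega⟩
  have hj : (σ j₀ : ℕ) + 1 = N := by simp [j₀]; omega
  obtain ⟨B, _, hB, h⟩ := hbd σ j₀ hj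
  exact sum_vert_last hm σ j₀ hj F hF B hB h

end Box

section LexSign

/-- A sign on integer vectors which is odd away from the origin: the sign of the first nonzero
coordinate, up to a factor depending on the parity of its index. -/
noncomputable def lexSign {n : ℕ} (x : Fin n → ℤ) : ZMod 2 :=
  open Classical in
  if ∃ i : Fin n, (∀ j < i, x j = 0) ∧ 0 < (-1) ^ (i.rev : ℕ) * x i then 1 else 0

lemma lexSign_zero {n : ℕ} {x : Fin n → ℤ} (hx : ∀ i, x i = 0) : lexSign x = 0 := by
  simp [lexSign, hx]

lemma lexSign_eq {n : ℕ} {x : Fin n → ℤ} (i : Fin n) (h : ∀ j < i, x j = 0) (hi : x i ≠ 0) :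
    lexSign x = if 0 < (-1) ^ (i.rev : ℕ) * x i then 1 else 0 := by
  have : (∃ i : Fin n, (∀ j < i, x j = 0) ∧ 0 < (-1) ^ (i.rev : ℕ) * x i) ↔
      0 < (-1) ^ (i.rev : ℕ) * x i := by
    refine ⟨fun ⟨j, h1, h2⟩ => ?_, fun h' => ⟨i, h, h'⟩⟩
    rcases lt_trichotomy i j with hij | rfl | hij
    · exact absurd (h1 i hij) hi
    · exact h2
    · rw [h j hij] at h2; simp at h2
  unfold lexSign
  simp only [this]

lemma exists_first_ne_zero {n : ℕ} {x : Fin n → ℤ} {i : Fin n} (hi : x i ≠ 0) :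
    ∃ i' ≤ i, (∀ j < i', x j = 0) ∧ x i' ≠ 0 := by
  induction i using WellFoundedLT.induction with
  | ind i ih =>
    by_cases h : ∀ j < i, x j = 0
    · exact ⟨i, le_rfl, h, hi⟩
    · push Not at h
      obtain ⟨j, hj, hx⟩ := h
      obtain ⟨i', h1, h2⟩ := ih j hj hx
      exact ⟨i', h1.trans hj.le, h2⟩

lemma lexSign_neg {n : ℕ} {x : Fin n → ℤ} {i : Fin n} (hi : x i ≠ 0) :
    lexSign (fun j => -x j) = lexSign x + 1 := by
  obtain ⟨i', -, h1, h2⟩ := exists_first_ne_zero hi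
  rw [lexSign_eq i' h1 h2, lexSign_eq i' (x := fun j => -x j) (by simpa using h1) (by simpa)]
  have h3 : (-1 : ℤ) ^ (i'.rev : ℕ) * x i' ≠ 0 := by simp [h2]
  rw [mul_neg]
  rcases lt_or_gt_of_ne h3 with h | h
  · rw [if_pos (by omega), if_neg (by omega), zero_add]
  · rw [if_neg (by omega), if_pos (by omega)]; decide

variable {n : ℕ} {σ : Fin n → ℕ} {κ : Fin n → ℤ × ℤ} {m : ℤ}

lemma lexSign_before (ho : ∀ i, (κ i).1 % 2 = 1) (he : ∀ i, (κ i).2 = 0)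
    (hmono : StrictMono σ) (i : Fin n) :
    lexSign (fun j => if σ j < σ i then (κ j).2 else (κ j).1) =
      if 0 < (-1) ^ (i.rev : ℕ) * (κ i).1 then 1 else 0 := by
  rw [lexSign_eq i]
  · simp
  · intro j hj
    simp [hmono hj, he]
  · have := ho i
    simp only [lt_irrefl, if_false]
    omega

lemma lexSign_after (ho : ∀ i, (κ i).1 % 2 = 1) (he : ∀ i, (κ i).2 = 0)
    (hmono : StrictMono σ) (i : Fin n) :
    lexSign (fun j => if σ j < σ i + 1 then (κ j).2 else (κ j).1) =
      if h : (i : ℕ) + 1 < n then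
        (if 0 < (-1) ^ (i.rev : ℕ) * (κ ⟨i + 1, h⟩).1 then 0 else 1) else 0 := by
  have hle : ∀ j : Fin n, j ≤ i → (if σ j < σ i + 1 then (κ j).2 else (κ j).1) = 0 := by
    intro j hj
    rw [if_pos (Nat.lt_succ_iff.mpr (hmono.monotone hj)), he]
  by_cases h : (i : ℕ) + 1 < n
  case neg =>
    rw [dif_neg h]
    exact lexSign_zero fun j => hle j (by rw [Fin.le_def]; omega)
  rw [dif_pos h]
  have h1 : ¬ σ ⟨i + 1, h⟩ < σ i + 1 := by
    have : σ i < σ ⟨i + 1, h⟩ := hmono (by rw [Fin.lt_def]; simp)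
    omega
  have h2 := ho ⟨i + 1, h⟩
  have h3 : (i.rev : ℕ) = ((⟨i + 1, h⟩ : Fin n).rev : ℕ) + 1 := by
    simp only [Fin.val_rev]; omega
  rw [lexSign_eq ⟨i + 1, h⟩, if_neg h1, h3, pow_succ]
  · rcases neg_one_pow_eq_or ℤ ((⟨i + 1, h⟩ : Fin n).rev : ℕ) with h5 | h5 <;> rw [h5] <;>
      split_ifs <;> first | rfl | omega
  · intro j hj
    exact hle j (by rw [Fin.lt_def] at hj; rw [Fin.le_def]; simp at hj; omega)
  · rw [if_neg h1]
    omega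

/-- The lattice paths all of whose steps change `lexSign`. -/
lemma lexSign_changes_iff (hσ : Function.Injective σ) (hκ : ∀ i, κ i ∈ boxEdges m) :
    (∀ i, lexSign (fun j => if σ j < σ i then (κ j).2 else (κ j).1) +
      lexSign (fun j => if σ j < σ i + 1 then (κ j).2 else (κ j).1) ≠ 0) ↔
    StrictMono σ ∧ ∀ i, κ i = (1, 0) := by
  have ho : ∀ i, (κ i).1 % 2 = 1 := fun i => (mem_boxEdges.mp (hκ i)).2.2.1
  constructor
  · intro H
    have Hne : ∀ i, lexSign (fun j => if σ j < σ i then (κ j).2 else (κ j).1) ≠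
        lexSign (fun j => if σ j < σ i + 1 then (κ j).2 else (κ j).1) := fun i h =>
      H i (by rw [h]; exact CharTwo.add_self_eq_zero _)
    have hagree : ∀ i j, j ≠ i → ((if σ j < σ i + 1 then (κ j).2 else (κ j).1) =
        if σ j < σ i then (κ j).2 else (κ j).1) := by
      intro i j hij
      have : σ j ≠ σ i := fun h => hij (hσ h)
      have : σ j < σ i + 1 ↔ σ j < σ i := by omega
      simp [this]
    have hfirst : ∀ i, ∀ j < i, (if σ j < σ i then (κ j).2 else (κ j).1) = 0 := by
      intro i
      have h0 : (fun j => if σ j < σ i then (κ j).2 else (κ j).1) i ≠ 0 := by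
        have := ho i
        simp only [lt_irrefl, if_false]
        omega
      obtain ⟨i', h1, h2, h3⟩ := exists_first_ne_zero
        (x := fun j => if σ j < σ i then (κ j).2 else (κ j).1) h0
      rcases h1.eq_or_lt with rfl | h1
      · exact h2
      · refine absurd ?_ (Hne i)
        rw [lexSign_eq i' h2 h3, lexSign_eq i']
        · rw [hagree i i' h1.ne]
        · intro j hj
          rw [hagree i j (hj.trans h1).ne]
          exact h2 j hj
        · rw [hagree i i' h1.ne]
          exact h3
    have hmono : StrictMono σ := by
      intro j i hji
      by_contra h
      have h1 := hfirst i j hji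
      have h2 := ho j
      rw [if_neg h] at h1
      omega
    have he : ∀ i, (κ i).2 = 0 := by
      intro i
      by_contra h
      have h2 := mem_boxEdges.mp (hκ i)
      refine Hne i ?_
      rw [lexSign_eq i (hfirst i), lexSign_eq i]
      · have : 0 < (-1) ^ (i.rev : ℕ) * (κ i).1 ↔ 0 < (-1) ^ (i.rev : ℕ) * (κ i).2 := by
          rcases neg_one_pow_eq_or ℤ (i.rev : ℕ) with h3 | h3 <;> rw [h3] <;> omega
        simp only [lt_irrefl, if_false, Nat.lt_succ_self, if_true, this]
      · intro j hj
        rw [hagree i j hj.ne]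
        exact hfirst i j hj
      · simpa using h
      · simp only [lt_irrefl, if_false]
        omega
    refine ⟨hmono, ?_⟩
    have hpos : ∀ q : ℕ, ∀ i : Fin n, (i.rev : ℕ) = q → (κ i).1 = 1 := by
      intro q
      induction q with
      | zero =>
        intro i hi
        have h1 := Hne i
        have h2 := mem_boxEdges.mp (hκ i)
        rw [lexSign_before ho he hmono, lexSign_after ho he hmono, hi, dif_neg] at h1
        · have h4 := he i
          by_contra h3
          rw [if_neg] at h1
          · exact h1 rfl
          · simp; omega
        · rw [Fin.val_rev] at hi; omega
      | succ q ih =>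
        intro i hi
        have h0 : (i : ℕ) + 1 < n := by rw [Fin.val_rev] at hi; omega
        have h3 := ih ⟨i + 1, h0⟩ (by simp only [Fin.val_rev] at hi ⊢; omega)
        have h1 := Hne i
        have h2 := mem_boxEdges.mp (hκ i)
        rw [lexSign_before ho he hmono, lexSign_after ho he hmono, dif_pos h0, h3] at h1
        have h4 := he i
        rcases neg_one_pow_eq_or ℤ (i.rev : ℕ) with h5 | h5 <;> rw [h5] at h1 <;>
          split_ifs at h1 <;> first | exact absurd rfl h1 | omega
    intro i
    exact Prod.ext (hpos _ i rfl) (he i)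
  · rintro ⟨hmono, h1⟩ i
    have he : ∀ i, (κ i).2 = 0 := fun i => by simp [h1 i]
    rw [lexSign_before ho he hmono, lexSign_after ho he hmono]
    simp only [h1, mul_one]
    split_ifs with h2 h3 h3
    · decide
    · decide
    · decide
    · exfalso
      have : (i.rev : ℕ) = 0 := by rw [Fin.val_rev]; omega
      rw [this] at h2
      exact h2 (by norm_num)

end LexSign

section Shuffles

/-- The coordinates of the product of two cubes of dimensions `2` and `k` and a cube of dimension
`k + 2`. -/
abbrev Coord (k : ℕ) : Type := (Fin 2 ⊕ Fin k) ⊕ Fin (k + 2)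

/-- The sum of the signs of the first two components of a point. -/
noncomputable def diagSign {k : ℕ} (x : Coord k → ℤ) : ZMod 2 :=
  lexSign (fun u => x (.inl (.inl u))) + lexSign (fun v => x (.inl (.inr v)))

/-- Orderings of the coordinates which shuffle the first two blocks and put the last one behind. -/
def IsShuffle {k : ℕ} (σ : Coord k ≃ Fin (k + 2 + (k + 2))) : Prop :=
  StrictMono (fun u => (σ (.inl (.inl u)) : ℕ)) ∧ StrictMono (fun v => (σ (.inl (.inr v)) : ℕ)) ∧
    ∀ w, (σ (.inr w) : ℕ) = k + 2 + w

variable {k : ℕ}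

lemma IsShuffle.lt {σ : Coord k ≃ Fin (k + 2 + (k + 2))} (hσ : IsShuffle σ)
    (j : Fin 2 ⊕ Fin k) : (σ (.inl j) : ℕ) < k + 2 := by
  by_contra h
  have h1 := hσ.2.2 ⟨(σ (.inl j) : ℕ) - (k + 2), by omega⟩
  have h2 : σ (.inr ⟨(σ (.inl j) : ℕ) - (k + 2), by omega⟩) = σ (.inl j) := by
    ext; rw [h1]; simp only; omega
  simpa using σ.injective h2

/-- The shuffle which moves the first block to a given set of positions. -/
noncomputable def shuffleOf (s : Finset (Fin (k + 2))) (hs : s.card = 2) (hs' : sᶜ.card = k) :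
    Coord k ≃ Fin (k + 2 + (k + 2)) :=
  (Equiv.sumCongr (finSumEquivOfFinset hs hs') (Equiv.refl _)).trans finSumFinEquiv

lemma isShuffle_shuffleOf (s : Finset (Fin (k + 2))) (hs : s.card = 2) (hs' : sᶜ.card = k) :
    IsShuffle (shuffleOf s hs hs') := by
  refine ⟨fun a b h => ?_, fun a b h => ?_, fun w => ?_⟩
  · simpa [shuffleOf] using h
  · simpa [shuffleOf] using h
  · simp [shuffleOf]
    omega

lemma card_shuffles (k : ℕ) [DecidablePred (IsShuffle (k := k))] :
    (Finset.univ.filter (IsShuffle (k := k))).card = (k + 2).choose 2 := by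
  have hc : ∀ s ∈ Finset.powersetCard 2 (Finset.univ : Finset (Fin (k + 2))),
      s.card = 2 ∧ sᶜ.card = k := by
    intro s hs
    have h := (Finset.mem_powersetCard.mp hs).2
    refine ⟨h, ?_⟩
    rw [Finset.card_compl, h, Fintype.card_fin]
    omega
  have := Finset.card_powersetCard 2 (Finset.univ : Finset (Fin (k + 2)))
  rw [Finset.card_univ, Fintype.card_fin] at this
  rw [← this]
  symm
  refine Finset.card_bij (fun s hs => shuffleOf s (hc s hs).1 (hc s hs).2) ?_ ?_ ?_
  · intro s hs
    simpa using isShuffle_shuffleOf s _ _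
  · intro s hs s' hs' h
    have key : ∀ (s : Finset (Fin (k + 2))) (hs : s.card = 2) (hs' : sᶜ.card = k),
        (s : Set (Fin (k + 2))) =
        Set.range fun u => finSumEquivOfFinset (s := s) hs hs' (.inl u) := by
      intro s hs hs'
      simp only [finSumEquivOfFinset_inl]
      rw [← Finset.range_orderEmbOfFin s hs]
    rw [← Finset.coe_inj, key s (hc s hs).1 (hc s hs).2, key s' (hc s' hs').1 (hc s' hs').2]
    congr 1
    funext u
    have := congrArg (fun τ : Coord k ≃ _ => τ (.inl (.inl u))) h
    simpa [shuffleOf] using this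
  · intro σ hσ
    have hσ : IsShuffle σ := by simpa using hσ
    set f : Fin 2 ⊕ Fin k → Fin (k + 2) := fun j => ⟨σ (.inl j), hσ.lt j⟩ with hf
    have hfi : Function.Injective f := by
      intro a b hab
      have : σ (.inl a) = σ (.inl b) := Fin.ext (by simpa [hf] using hab)
      simpa using σ.injective this
    set s : Finset (Fin (k + 2)) := Finset.univ.image fun u => f (.inl u) with hs
    have h1 : s.card = 2 := by
      rw [hs, Finset.card_image_of_injective _
        (show Function.Injective (fun u => f (.inl u)) from hfi.comp Sum.inl_injective)]
      simp
    have h2 : s ∈ Finset.powersetCard 2 (Finset.univ : Finset (Fin (k + 2))) := by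
      simp [Finset.mem_powersetCard, h1]
    refine ⟨s, h2, ?_⟩
    have e1 := Finset.orderEmbOfFin_unique (hc s h2).1 (f := fun u => f (.inl u))
      (fun u => by simp [hs]) (fun a b h => hσ.1 h)
    have e2 := Finset.orderEmbOfFin_unique (hc s h2).2 (f := fun v => f (.inr v))
      (fun v => by
        simp only [hs, Finset.mem_compl, Finset.mem_image, Finset.mem_univ, true_and, not_exists]
        intro u hu
        simpa using hfi hu) (fun a b h => hσ.2.1 h)
    ext j
    rcases j with (u | v) | w
    · simp [shuffleOf, ← e1, hf]
    · simp [shuffleOf, ← e2, hf]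
    · simp [shuffleOf, hσ.2.2 w]
      omega

variable {κ : Coord k → ℤ × ℤ} {σ : Coord k ≃ Fin (k + 2 + (k + 2))} {m : ℤ}

lemma vert_succ_of_ne {i : ℕ} {j : Coord k} (h : (σ j : ℕ) ≠ i) :
    vert κ σ (i + 1) j = vert κ σ i j := by
  have : (σ j : ℕ) < i + 1 ↔ (σ j : ℕ) < i := by omega
  simp [vert, this]

lemma diagSign_step_left (u : Fin 2) :
    diagSign (vert κ σ (σ (.inl (.inl u)))) + diagSign (vert κ σ (σ (.inl (.inl u)) + 1)) =
      lexSign (fun u' => vert κ σ (σ (.inl (.inl u))) (.inl (.inl u'))) +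
        lexSign (fun u' => vert κ σ (σ (.inl (.inl u)) + 1) (.inl (.inl u'))) := by
  have : (fun v => vert κ σ (σ (.inl (.inl u)) + 1) (.inl (.inr v))) =
      fun v => vert κ σ (σ (.inl (.inl u))) (.inl (.inr v)) :=
    funext fun v => vert_succ_of_ne (by simp [Fin.val_inj])
  simp only [diagSign, this]
  rw [add_add_add_comm, CharTwo.add_self_eq_zero (lexSign fun v => _), add_zero]

lemma diagSign_step_right (v : Fin k) :
    diagSign (vert κ σ (σ (.inl (.inr v)))) + diagSign (vert κ σ (σ (.inl (.inr v)) + 1)) =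
      lexSign (fun v' => vert κ σ (σ (.inl (.inr v))) (.inl (.inr v'))) +
        lexSign (fun v' => vert κ σ (σ (.inl (.inr v)) + 1) (.inl (.inr v'))) := by
  have : (fun u => vert κ σ (σ (.inl (.inr v)) + 1) (.inl (.inl u))) =
      fun u => vert κ σ (σ (.inl (.inr v))) (.inl (.inl u)) :=
    funext fun u => vert_succ_of_ne (by simp [Fin.val_inj])
  simp only [diagSign, this]
  rw [add_add_add_comm, CharTwo.add_self_eq_zero (lexSign fun u => _), zero_add]

lemma diagSign_step_last (w : Fin (k + 2)) :
    diagSign (vert κ σ (σ (.inr w))) + diagSign (vert κ σ (σ (.inr w) + 1)) = 0 := by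
  have : ∀ j, vert κ σ (σ (.inr w) + 1) (.inl j) = vert κ σ (σ (.inr w)) (.inl j) :=
    fun j => vert_succ_of_ne (by simp [Fin.val_inj])
  simp only [diagSign, this]
  exact CharTwo.add_self_eq_zero _

lemma cup_diagSign_ne_zero_iff (hκ : κ ∈ boxCells (Coord k) m)
    (h : ℕ → (Coord k → ℤ) → ZMod 2)
    (hcenter : ∀ x, (∀ j, x (.inl j) = 0) → ∀ i : Fin (k + 2),
      h i x = if 0 < x (.inr i) then 1 else 0) :
    cup (k + 2 + (k + 2)) (fun i => if i < k + 2 then diagSign else h (i - (k + 2)))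
      (vert κ σ) ≠ 0 ↔ (∀ j, κ j = (1, 0)) ∧ IsShuffle σ := by
  rw [mem_boxCells] at hκ
  have hU := lexSign_changes_iff (σ := fun u => (σ (.inl (.inl u)) : ℕ))
    (κ := fun u => κ (.inl (.inl u)))
    (fun a b hab => by simpa using σ.injective (Fin.ext hab)) (fun i => hκ _)
  have hV := lexSign_changes_iff (σ := fun u => (σ (.inl (.inr u)) : ℕ))
    (κ := fun u => κ (.inl (.inr u)))
    (fun a b hab => by simpa using σ.injective (Fin.ext hab)) (fun i => hκ _)
  simp only [cup, Finset.prod_ne_zero_iff, Finset.mem_range]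
  constructor
  · intro H
    have hfirst : ∀ i : Fin (k + 2), ∃ j, (σ (.inl j) : ℕ) = i := by
      intro i
      have h1 := H i (by omega)
      simp only [i.isLt, if_true] at h1
      have hi : (i : ℕ) < k + 2 + (k + 2) := by omega
      rcases hj : σ.symm ⟨i, hi⟩ with j | w
      · exact ⟨j, by simp [← hj]⟩
      · refine absurd ?_ h1
        have : (σ (.inr w) : ℕ) = i := by simp [← hj]
        rw [← this]
        exact diagSign_step_last w
    choose f hf using hfirst
    have hfi : Function.Injective f := fun a b hab => by
      ext; rw [← hf a, ← hf b, hab]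
    have hfb : Function.Bijective f :=
      (Fintype.bijective_iff_injective_and_card f).mpr ⟨hfi, by simp; omega⟩
    have hlt : ∀ j, (σ (.inl j) : ℕ) < k + 2 := by
      intro j
      obtain ⟨i, rfl⟩ := hfb.2 j
      rw [hf]; exact i.isLt
    obtain ⟨hU1, hU2⟩ := hU.mp fun u => by
      have h1 := H (σ (.inl (.inl u))) (by omega)
      simp only [hlt, if_true] at h1
      rwa [diagSign_step_left] at h1
    obtain ⟨hV1, hV2⟩ := hV.mp fun v => by
      have h1 := H (σ (.inl (.inr v))) (by omega)
      simp only [hlt, if_true] at h1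
      rwa [diagSign_step_right] at h1
    have hκ0 : ∀ j, κ (.inl j) = (1, 0) := by
      rintro (u | v)
      · exact hU2 u
      · exact hV2 v
    have hlast : ∀ i : Fin (k + 2), (σ (.inr i) : ℕ) = k + 2 + i ∧ κ (.inr i) = (1, 0) := by
      intro i
      have h1 := H (k + 2 + i) (by omega)
      have hz : ∀ j l, k + 2 ≤ l → vert κ σ l (.inl j) = 0 := by
        intro j l hl
        have := hlt j
        simp [vert, show (σ (.inl j) : ℕ) < l by omega, hκ0]
      rw [if_neg (by omega), Nat.add_sub_cancel_left,
        hcenter _ (fun j => hz j _ (by omega)), hcenter _ (fun j => hz j _ (by omega))] at h1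
      have h2 : (σ (.inr i) : ℕ) = k + 2 + i := by
        by_contra h2
        rw [vert_succ_of_ne h2] at h1
        exact h1 (CharTwo.add_self_eq_zero _)
      refine ⟨h2, ?_⟩
      have h3 := mem_boxEdges.mp (hκ (.inr i))
      simp only [vert, h2, lt_irrefl, if_false, Nat.lt_succ_self, if_true] at h1
      have h4 : 0 < (κ (.inr i)).1 ∧ (κ (.inr i)).2 ≤ 0 ∨
          (κ (.inr i)).1 ≤ 0 ∧ 0 < (κ (.inr i)).2 := by
        by_contra h4
        apply h1
        split_ifs <;> first | rfl | omega
      exact Prod.ext (by simp only; omega) (by simp only; omega)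
    refine ⟨?_, hU1, hV1, fun w => (hlast w).1⟩
    rintro (j | w)
    · exact hκ0 j
    · exact (hlast w).2
  · rintro ⟨hκ1, hσ⟩ i hi
    split_ifs with hid
    · rcases hj : σ.symm ⟨i, hi⟩ with (u | v) | w
      · have : (σ (.inl (.inl u)) : ℕ) = i := by simp [← hj]
        rw [← this, diagSign_step_left]
        exact hU.mpr ⟨hσ.1, fun _ => hκ1 _⟩ u
      · have : (σ (.inl (.inr v)) : ℕ) = i := by simp [← hj]
        rw [← this, diagSign_step_right]
        exact hV.mpr ⟨hσ.2.1, fun _ => hκ1 _⟩ v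
      · have : (σ (.inr w) : ℕ) = i := by simp [← hj]
        rw [hσ.2.2 w] at this
        omega
    · have hz : ∀ j l, k + 2 ≤ l → vert κ σ l (.inl j) = 0 := by
        intro j l hl
        have := hσ.lt j
        simp [vert, show (σ (.inl j) : ℕ) < l by omega, hκ1]
      have h1 := hcenter (vert κ σ i) (fun j => hz j _ (by omega)) ⟨i - (k + 2), by omega⟩
      have h2 := hcenter (vert κ σ (i + 1)) (fun j => hz j _ (by omega)) ⟨i - (k + 2), by omega⟩
      simp only at h1 h2
      rw [h1, h2]
      have h3 := hσ.2.2 ⟨i - (k + 2), by omega⟩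
      have h4 : (σ (.inr ⟨i - (k + 2), by omega⟩) : ℕ) = i := by rw [h3]; simp only; omega
      simp [vert, h4, hκ1]

lemma sum_cup_diagSign (hm : 1 ≤ m) (h : ℕ → (Coord k → ℤ) → ZMod 2)
    (hcenter : ∀ x, (∀ j, x (.inl j) = 0) → ∀ i : Fin (k + 2),
      h i x = if 0 < x (.inr i) then 1 else 0) :
    ∑ κ ∈ boxCells (Coord k) m, ∑ σ : Coord k ≃ Fin (k + 2 + (k + 2)),
      cup (k + 2 + (k + 2)) (fun i => if i < k + 2 then diagSign else h (i - (k + 2)))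
        (vert κ σ) = ((k + 2).choose 2 : ℕ) := by
  classical
  have hval : ∀ κ ∈ boxCells (Coord k) m, ∀ σ : Coord k ≃ Fin (k + 2 + (k + 2)),
      cup (k + 2 + (k + 2)) (fun i => if i < k + 2 then diagSign else h (i - (k + 2)))
        (vert κ σ) = if (∀ j, κ j = (1, 0)) ∧ IsShuffle σ then 1 else 0 := by
    intro κ hκ σ
    have h1 := cup_diagSign_ne_zero_iff (σ := σ) hκ h hcenter
    split_ifs with h2
    · have h3 := h1.mpr h2
      revert h3
      generalize cup _ _ _ = q
      revert q
      decide
    · by_contra h3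
      exact h2 (h1.mp h3)
  rw [Finset.sum_congr rfl fun κ hκ => Finset.sum_congr rfl fun σ _ => hval κ hκ σ]
  rw [Finset.sum_eq_single (fun _ => (1, 0))]
  · simp only [implies_true, true_and]
    rw [Finset.sum_boole, card_shuffles]
  · intro κ _ hκ
    refine Finset.sum_eq_zero fun σ _ => if_neg fun h => hκ (funext h.1)
  · intro hκ
    refine absurd (mem_boxCells.mpr fun j => mem_boxEdges.mpr ?_) hκ
    simp only
    omega

end Shuffles

section Vanishing

lemma cup_eq_zero {P : Type*} {n i : ℕ} (hi : i < n) {s : ℕ → P → ZMod 2} {x : ℕ → P}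
    (h : s i (x i) = s i (x (i + 1))) : cup n s x = 0 :=
  Finset.prod_eq_zero (Finset.mem_range.mpr hi) (by rw [h]; exact CharTwo.add_self_eq_zero _)

lemma cup_eq_of_add_const {P : Type*} {n : ℕ} {s : ℕ → P → ZMod 2} {x y : ℕ → P}
    (h : ∀ i < n, ∃ c, ∀ l ≤ n, s i (y l) = s i (x l) + c) : cup n s y = cup n s x := by
  refine Finset.prod_congr rfl fun i hi => ?_
  have hi := Finset.mem_range.mp hi
  obtain ⟨c, hc⟩ := h i hi
  rw [hc i hi.le, hc (i + 1) hi, add_add_add_comm, CharTwo.add_self_eq_zero c, add_zero]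

lemma cup_update_add {P : Type*} {n r : ℕ} (hr : r < n) (s : ℕ → P → ZMod 2)
    (a b : P → ZMod 2) (x : ℕ → P) :
    cup n (Function.update s r fun p => a p + b p) x =
      cup n (Function.update s r a) x + cup n (Function.update s r b) x := by
  have h : ∀ t : P → ZMod 2, cup n (Function.update s r t) x =
      (t (x r) + t (x (r + 1))) *
        ∏ i ∈ (Finset.range n).erase r, (s i (x i) + s i (x (i + 1))) := by
    intro t
    rw [cup, ← Finset.mul_prod_erase _ _ (Finset.mem_range.mpr hr), Function.update_self]
    congr 1
    refine Finset.prod_congr rfl fun i hi => ?_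
    rw [Function.update_of_ne (Finset.ne_of_mem_erase hi)]
  rw [h, h, h]
  ring

/-- A set of lattice points which is contained in the box `[-m, m] ^ ι` and in a unit cube. -/
def IsSmallIn {ι : Type*} (m : ℤ) (S : Set (ι → ℤ)) : Prop :=
  (∀ x ∈ S, ∀ j, |x j| ≤ m) ∧ ∀ x ∈ S, ∀ y ∈ S, ∀ j, |x j - y j| ≤ 1

/-- A function is constant on a set. -/
def ConstOn {P : Type*} (f : P → ZMod 2) (S : Set P) : Prop :=
  ∀ x ∈ S, ∀ y ∈ S, f x = f y

lemma isSmallIn_vert {ι : Type*} [Fintype ι] [DecidableEq ι] {N : ℕ} {m : ℤ} {κ : ι → ℤ × ℤ}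
    (hκ : κ ∈ boxCells ι m) (σ : ι ≃ Fin N) : IsSmallIn m (Set.range (vert κ σ)) := by
  rw [mem_boxCells] at hκ
  constructor
  · rintro _ ⟨l, rfl⟩ j
    have := mem_boxEdges.mp (hκ j)
    rw [abs_le]
    simp only [vert]
    split_ifs <;> omega
  · rintro _ ⟨l, rfl⟩ _ ⟨l', rfl⟩ j
    have := mem_boxEdges.mp (hκ j)
    rw [abs_le]
    simp only [vert]
    split_ifs <;> omega

lemma IsSmallIn.reflect {ι : Type*} {m : ℤ} {S : Set (ι → ℤ)} (hS : IsSmallIn m S)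
    (B : ι → Prop) [DecidablePred B] : IsSmallIn m (reflect B '' S) := by
  constructor
  · rintro _ ⟨x, hx, rfl⟩ j
    have := hS.1 x hx j
    simp only [_root_.reflect]
    split_ifs <;> simpa
  · rintro _ ⟨x, hx, rfl⟩ _ ⟨y, hy, rfl⟩ j
    have := hS.2 x hx y hy j
    simp only [_root_.reflect]
    split_ifs
    · rwa [neg_sub_neg, abs_sub_comm]
    · exact this

/-- The parity of a binomial coefficient as an obstruction to sign labellings `h` and `g` of the
lattice points of a box. -/
theorem choose_two_eq_zero_of_labelling (k : ℕ) {m : ℤ} (hm : m % 2 = 1) (hm1 : 1 ≤ m)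
    (h g : ℕ → (Coord k → ℤ) → ZMod 2)
    (hleft : ∀ x y : Coord k → ℤ, (∀ j, |x j| ≤ m) → ∀ u, |x (.inl (.inl u))| = m →
      (∀ u, y (.inl (.inl u)) = -x (.inl (.inl u))) →
      (∀ v, y (.inl (.inr v)) = x (.inl (.inr v))) → (∀ w, y (.inr w) = x (.inr w)) →
      ∀ i, h i y = h i x + 1 ∧ g i y = g i x + 1)
    (hright : ∀ x y : Coord k → ℤ, (∀ j, |x j| ≤ m) → ∀ v, |x (.inl (.inr v))| = m →
      (∀ u, y (.inl (.inl u)) = x (.inl (.inl u))) →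
      (∀ v, y (.inl (.inr v)) = -x (.inl (.inr v))) → (∀ w, y (.inr w) = x (.inr w)) →
      ∀ i, h i y = h i x ∧ g i y = g i x + 1)
    (hsmall : ∀ S : Set (Coord k → ℤ), IsSmallIn m S →
      ∃ i < k + 2, ConstOn (h i) S ∨ ConstOn (g i) S)
    (hlast : ∀ S : Set (Coord k → ℤ), IsSmallIn m S → ∀ w, (∀ x ∈ S, |x (.inr w)| = m) →
      ∃ i < k + 2, ConstOn (h i) S)
    (hcenter : ∀ x, (∀ j, x (.inl j) = 0) → ∀ i : Fin (k + 2),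
      h i x = if 0 < x (.inr i) then 1 else 0) :
    (((k + 2).choose 2 : ℕ) : ZMod 2) = 0 := by
  set N := k + 2 + (k + 2) with hN
  set s : ℕ → ℕ → (Coord k → ℤ) → ZMod 2 := fun r i =>
    if i < r then diagSign else if i < k + 2 then g i else h (i - (k + 2)) with hs
  set Z : ℕ → ZMod 2 := fun r =>
    ∑ κ ∈ boxCells (Coord k) m, ∑ σ : Coord k ≃ Fin N, cup N (s r) (vert κ σ) with hZ
  have hZ0 : Z 0 = 0 := by
    refine Finset.sum_eq_zero fun κ hκ => Finset.sum_eq_zero fun σ _ => ?_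
    obtain ⟨i, hi, hc | hc⟩ := hsmall _ (isSmallIn_vert hκ σ)
    · refine cup_eq_zero (i := k + 2 + i) (by omega) ?_
      have : s 0 (k + 2 + i) = h i := by simp [hs]
      rw [this]
      exact hc _ ⟨_, rfl⟩ _ ⟨_, rfl⟩
    · refine cup_eq_zero (i := i) (by omega) ?_
      have : s 0 i = g i := by simp [hs, hi]
      rw [this]
      exact hc _ ⟨_, rfl⟩ _ ⟨_, rfl⟩
  have hZd : Z (k + 2) = ((k + 2).choose 2 : ℕ) := by
    rw [← sum_cup_diagSign hm1 h hcenter]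
    have : s (k + 2) = fun i => if i < k + 2 then diagSign else h (i - (k + 2)) := by
      funext i
      simp only [hs]
      split_ifs <;> rfl
    simp only [hZ, this]
    rfl
  have hneg1 : ∀ x y : Coord k → ℤ, ∀ u, |x (.inl (.inl u))| = m →
      (∀ u, y (.inl (.inl u)) = -x (.inl (.inl u))) →
      (∀ v, y (.inl (.inr v)) = x (.inl (.inr v))) → diagSign y = diagSign x + 1 := by
    intro x y u hu h1 h2
    have : x (.inl (.inl u)) ≠ 0 := by intro h0; rw [h0, abs_zero] at hu; omega
    simp only [diagSign, h1, h2]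
    rw [lexSign_neg (x := fun u => x (.inl (.inl u))) this]
    ring
  have hneg2 : ∀ x y : Coord k → ℤ, ∀ v, |x (.inl (.inr v))| = m →
      (∀ u, y (.inl (.inl u)) = x (.inl (.inl u))) →
      (∀ v, y (.inl (.inr v)) = -x (.inl (.inr v))) → diagSign y = diagSign x + 1 := by
    intro x y v hv h1 h2
    have : x (.inl (.inr v)) ≠ 0 := by intro h0; rw [h0, abs_zero] at hv; omega
    simp only [diagSign, h1, h2]
    rw [lexSign_neg (x := fun u => x (.inl (.inr u))) this]
    ring
  have hstep : ∀ r < k + 2, Z r = Z (r + 1) := by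
    intro r hr
    set t : (Coord k → ℤ) → ZMod 2 := fun p => g r p + diagSign p with ht
    set F : (ℕ → Coord k → ℤ) → ZMod 2 :=
      fun x => cup (N - 1) (skip r (s r)) x * t (x r) with hFdef
    have hadd : ∀ x, cup N (s r) x + cup N (s (r + 1)) x =
        ∑ l ∈ Finset.range (N + 1), F (skip l x) := by
      intro x
      have e0 : N - 1 + 2 = N + 1 := by omega
      have e1 : Function.update (s r) r (g r) = s r := by
        rw [Function.update_eq_self_iff]
        simp [hs, hr]
      have e2 : Function.update (s r) r diagSign = s (r + 1) := by
        funext i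
        by_cases hi : i = r
        · subst hi; simp [hs]
        · rw [Function.update_of_ne hi]
          have : i < r + 1 ↔ i < r := by omega
          simp only [hs, this]
      have e3 := sum_cup_skip_mul (N - 1) r (by omega) (s r) t x
      rw [e0, show N - 1 + 1 = N by omega, ht, cup_update_add (by omega), e1, e2] at e3
      exact e3.symm
    have hzero : ∑ κ ∈ boxCells (Coord k) m, ∑ σ : Coord k ≃ Fin N,
        ∑ l ∈ Finset.range (N + 1), F (skip l (vert κ σ)) = 0 := by
      refine sum_boundary_eq_zero hm (by omega) F ?_ ?_
      · intro x y hxy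
        simp only [hFdef, hxy r (by omega)]
        congr 1
        refine (cup_eq_of_add_const fun i hi => ⟨0, fun l hl => ?_⟩).symm
        rw [hxy l (by omega), add_zero]
      · intro σ j₀ hj₀
        have hface : ∀ κ l, l < N → vert κ σ l j₀ = (κ j₀).1 := by
          intro κ l hl
          simp [vert, show ¬ (σ j₀ : ℕ) < l by omega]
        have hcancel : ∀ (x y : ℕ → Coord k → ℤ) (c : ZMod 2),
            (∀ l < N, ∀ i, h i (y l) = h i (x l) + c ∧ g i (y l) = g i (x l) + 1) →
            (∀ l < N, diagSign (y l) = diagSign (x l) + 1) → F x + F y = 0 := by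
          intro x y c h1 h2
          have e1 : t (y r) = t (x r) := by
            simp only [ht]
            rw [(h1 r (by omega) r).2, h2 r (by omega), add_add_add_comm,
              CharTwo.add_self_eq_zero (1 : ZMod 2), add_zero]
          have e2 : cup (N - 1) (skip r (s r)) y = cup (N - 1) (skip r (s r)) x := by
            refine cup_eq_of_add_const fun i hi => ?_
            have h3 : ∀ q, ∃ c, ∀ l < N, s r q (y l) = s r q (x l) + c := by
              intro q
              simp only [hs]
              split_ifs
              · exact ⟨1, h2⟩
              · exact ⟨1, fun l hl => (h1 l hl q).2⟩
              · exact ⟨c, fun l hl => (h1 l hl _).1⟩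
            simp only [skip]
            split_ifs
            · obtain ⟨c, hc⟩ := h3 i
              exact ⟨c, fun l hl => hc l (by omega)⟩
            · obtain ⟨c, hc⟩ := h3 (i + 1)
              exact ⟨c, fun l hl => hc l (by omega)⟩
          simp only [hFdef, e1, e2]
          exact CharTwo.add_self_eq_zero _
        classical
        rcases j₀ with (u | v) | w
        · refine ⟨fun j => ∃ u, j = .inl (.inl u), inferInstance, ⟨u, rfl⟩, fun κ hκ hm0 => ?_⟩
          have hx : ∀ l < N, |vert κ σ l (.inl (.inl u))| = m := fun l hl => by rwa [hface κ l hl]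
          refine hcancel _ _ 1 (fun l hl => ?_) (fun l hl => ?_)
          · exact hleft _ _ ((isSmallIn_vert hκ σ).1 _ ⟨l, rfl⟩) u (hx l hl) (by simp [reflect])
              (by simp [reflect]) (by simp [reflect])
          · exact hneg1 _ _ u (hx l hl) (by simp [reflect]) (by simp [reflect])
        · refine ⟨fun j => ∃ v, j = .inl (.inr v), inferInstance, ⟨v, rfl⟩, fun κ hκ hm0 => ?_⟩
          have hx : ∀ l < N, |vert κ σ l (.inl (.inr v))| = m := fun l hl => by rwa [hface κ l hl]
          refine hcancel _ _ 0 (fun l hl i => ?_) (fun l hl => ?_)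
          · rw [add_zero]
            exact hright _ _ ((isSmallIn_vert hκ σ).1 _ ⟨l, rfl⟩) v (hx l hl) (by simp [reflect])
              (by simp [reflect]) (by simp [reflect]) i
          · exact hneg2 _ _ v (hx l hl) (by simp [reflect]) (by simp [reflect])
        · refine ⟨fun j => ∃ w, j = .inr w, inferInstance, ⟨w, rfl⟩, fun κ hκ hm0 => ?_⟩
          have hx : ∀ l < N, |vert κ σ l (.inr w)| = m := fun l hl => by rwa [hface κ l hl]
          have hF0 : ∀ (x : ℕ → Coord k → ℤ) (S : Set (Coord k → ℤ)), IsSmallIn m S →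
              (∀ l < N, x l ∈ S) → (∀ p ∈ S, |p (.inr w)| = m) → F x = 0 := by
            intro x S hS hxS hSm
            obtain ⟨i, hi, hc⟩ := hlast S hS w hSm
            have : skip r (s r) (k + 2 + i - 1) = h i := by
              simp only [skip, hs]
              rw [if_neg (by omega), if_neg (by omega), if_neg (by omega)]
              congr 1
              omega
            rw [hFdef]
            refine mul_eq_zero_of_left (cup_eq_zero (i := k + 2 + i - 1) (by omega) ?_) _
            rw [this]
            exact hc _ (hxS _ (by omega)) _ (hxS _ (by omega))
          have hS : IsSmallIn m (vert κ σ '' {l | l < N}) :=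
            ⟨fun x hx => (isSmallIn_vert hκ σ).1 x (Set.image_subset_range _ _ hx),
              fun x hx y hy => (isSmallIn_vert hκ σ).2 x (Set.image_subset_range _ _ hx) y
                (Set.image_subset_range _ _ hy)⟩
          rw [hF0 _ _ hS (fun l hl => ⟨l, hl, rfl⟩), hF0 _ _ (hS.reflect _)
            (fun l hl => ⟨_, ⟨l, hl, rfl⟩, rfl⟩), add_zero]
          · rintro _ ⟨_, ⟨l, hl, rfl⟩, rfl⟩
            simpa [reflect] using hx l hl
          · rintro _ ⟨l, hl, rfl⟩
            exact hx l hl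
    have : Z r + Z (r + 1) = 0 := by
      rw [← hzero]
      simp only [hZ, ← Finset.sum_add_distrib, hadd]
    exact CharTwo.add_eq_zero.mp this
  have hall : ∀ r ≤ k + 2, Z r = 0 := by
    intro r
    induction r with
    | zero => exact fun _ => hZ0
    | succ r ih => exact fun hr => by rw [← hstep r (by omega), ih (by omega)]
  rw [← hZd, hall _ le_rfl]

end Vanishing

section Discretization

/-- The sign of a real number, with a prescribed value at zero. -/
noncomputable def signOr (t : ℝ) (e : ZMod 2) : ZMod 2 :=
  if 0 < t then 1 else if t < 0 then 0 else e

lemma signOr_neg_add_one (t : ℝ) (e : ZMod 2) : signOr (-t) (e + 1) = signOr t e + 1 := by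
  unfold signOr
  rcases lt_trichotomy t 0 with h | rfl | h
  · simp [h, h.not_gt]
  · simp
  · simp [h, h.not_gt]
    decide

/-- Rescaling of lattice points. -/
noncomputable def scale {ι : Type*} (m : ℤ) (x : ι → ℤ) : ι → ℝ := fun j => x j / m

lemma norm_scale_eq_one {n : ℕ} {m : ℤ} (hm : 1 ≤ m) {x : Fin n → ℤ} (hx : ∀ j, |x j| ≤ m)
    {i : Fin n} (hi : |x i| = m) : ‖scale m x‖ = 1 := by
  have hm' : (0 : ℝ) < m := by exact_mod_cast hm
  have h : ∀ j, ‖scale m x j‖ = |x j| / m := fun j => by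
    simp [scale, abs_of_pos hm']
  apply le_antisymm
  · refine (pi_norm_le_iff_of_nonneg zero_le_one).mpr fun j => ?_
    rw [h, div_le_one hm']
    exact_mod_cast hx j
  · refine le_trans ?_ (norm_le_pi_norm _ i)
    rw [h, hi, div_self hm'.ne']

lemma exists_forall_isSmallIn_sign {ι J : Type*} [Fintype ι] [Nonempty J]
    {C : Set (ι → ℝ)} (hC : IsCompact C) {φ : (ι → ℝ) → J → ℝ} (hφ : Continuous φ)
    (h0 : ∀ x ∈ C, φ x ≠ 0) :
    ∃ M : ℕ, ∀ m : ℤ, (M : ℤ) ≤ m → 1 ≤ m → ∀ S : Set (ι → ℤ), IsSmallIn m S →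
      (∀ x ∈ S, scale m x ∈ C) →
      ∃ j, (∀ x ∈ S, 0 < φ (scale m x) j) ∨ (∀ x ∈ S, φ (scale m x) j < 0) := by
  obtain ⟨δ, hδ, hcov⟩ := lebesgue_number_lemma_of_metric (s := C)
    (c := fun e : J × Bool => if e.2 then {x | 0 < φ x e.1} else {x | φ x e.1 < 0}) hC
    (by
      rintro ⟨j, e⟩
      have hj : Continuous fun x => φ x j := (continuous_apply j).comp hφ
      cases e
      · simpa using isOpen_lt hj continuous_const
      · simpa using isOpen_lt continuous_const hj)
    (by
      intro x hx
      obtain ⟨j, hj⟩ := Function.ne_iff.mp (h0 x hx)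
      rw [Set.mem_iUnion]
      rcases lt_or_gt_of_ne hj with h | h
      · exact ⟨(j, false), by simpa using h⟩
      · exact ⟨(j, true), by simpa using h⟩)
  obtain ⟨M, hM⟩ := exists_nat_gt δ⁻¹
  refine ⟨M, fun m hMm hm S hS hSC => ?_⟩
  have hm' : (0 : ℝ) < m := by exact_mod_cast hm
  rcases S.eq_empty_or_nonempty with rfl | ⟨x₀, hx₀⟩
  · exact ⟨Classical.arbitrary J, by simp⟩
  obtain ⟨⟨j, e⟩, hsub⟩ := hcov _ (hSC x₀ hx₀)
  have hball : ∀ x ∈ S, scale m x ∈ Metric.ball (scale m x₀) δ := by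
    intro x hx
    rw [Metric.mem_ball, dist_pi_lt_iff hδ]
    intro i
    have h1 : |(x i : ℝ) - x₀ i| ≤ 1 := by exact_mod_cast hS.2 x hx x₀ hx₀ i
    have h2 : δ⁻¹ < m := hM.trans_le (by exact_mod_cast hMm)
    rw [Real.dist_eq, scale, scale, ← sub_div, abs_div, abs_of_pos hm', div_lt_iff₀ hm']
    calc _ ≤ (1 : ℝ) := h1
      _ = δ * δ⁻¹ := (mul_inv_cancel₀ hδ.ne').symm
      _ < δ * m := by gcongr
  refine ⟨j, ?_⟩
  cases e
  · exact Or.inr fun x hx => by simpa using hsub (hball x hx)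
  · exact Or.inl fun x hx => by simpa using hsub (hball x hx)

end Discretization

section Pencil

open Topology

variable {k : ℕ} (V W : EuclideanSpace ℝ (Fin (k + 2)) → EuclideanSpace ℝ (Fin (k + 2)))

/-- The combination of the fields `V`, `W` and the identity whose coefficients are the coordinates
of the point over `a` of a polyhedral half-sphere. -/
noncomputable def pencil (a : Fin 2 → ℝ) (x : EuclideanSpace ℝ (Fin (k + 2))) :
    EuclideanSpace ℝ (Fin (k + 2)) :=
  a 0 • V x + a 1 • W x + (1 - ‖a‖) • x

/-- The point over `b` of a polyhedral half-sphere of dimension `k`. -/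
noncomputable def halfSphere (b : Fin k → ℝ) : EuclideanSpace ℝ (Fin (k + 2)) :=
  WithLp.toLp 2 (Fin.append b ![1 - ‖b‖, 0])

lemma halfSphere_ne_zero (b : Fin k → ℝ) : halfSphere b ≠ 0 := by
  intro h
  have hb : b = 0 := funext fun j => by
    simpa [halfSphere] using congrArg (fun z => z (Fin.castAdd 2 j)) h
  have := congrArg (fun z => z (Fin.natAdd k 0)) h
  simp [halfSphere, hb] at this

lemma halfSphere_neg {b : Fin k → ℝ} (hb : ‖b‖ = 1) : halfSphere (-b) = -halfSphere b := by
  ext j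
  refine Fin.addCases (fun j => ?_) (fun j => ?_) j
  · simp [halfSphere]
  · fin_cases j <;> simp [halfSphere, hb]

lemma continuous_halfSphere : Continuous (halfSphere (k := k)) := by
  refine (PiLp.continuous_toLp 2 _).comp (continuous_pi fun j => ?_)
  refine Fin.addCases (fun j => ?_) (fun j => ?_) j
  · simp only [Fin.append_left]
    fun_prop
  · fin_cases j <;> simp <;> fun_prop

lemma pencil_neg {a : Fin 2 → ℝ} (ha : ‖a‖ = 1) (x : EuclideanSpace ℝ (Fin (k + 2))) :
    pencil V W (-a) x = -pencil V W a x := by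
  simp [pencil, ha]
  abel

lemma pencil_eq_zero {V W : EuclideanSpace ℝ (Fin (k + 2)) → EuclideanSpace ℝ (Fin (k + 2))}
    (h : ∀ (a b c : ℝ) x, a • V x + b • W x + c • x = 0 → x = 0 ∨ (a = 0 ∧ b = 0 ∧ c = 0))
    {a : Fin 2 → ℝ} {x : EuclideanSpace ℝ (Fin (k + 2))} (hx : pencil V W a x = 0) : x = 0 := by
  refine (h _ _ _ _ hx).resolve_right ?_
  rintro ⟨h0, h1, h2⟩
  have : a = 0 := by ext i; fin_cases i <;> assumption
  simp [this] at h2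

/-- The values of the pencil at the two points at distance `r` from a given one in a given
direction, combined with the sign `e`. -/
noncomputable def twoPoint (e r : ℝ) (x : Coord k → ℝ) : EuclideanSpace ℝ (Fin (k + 2)) :=
  pencil V W (fun u => x (.inl (.inl u)))
      (WithLp.toLp 2 (fun w => x (.inr w)) + r • halfSphere fun v => x (.inl (.inr v))) +
    e • pencil V W (fun u => x (.inl (.inl u)))
      (WithLp.toLp 2 (fun w => x (.inr w)) - r • halfSphere fun v => x (.inl (.inr v)))

variable {V W}

lemma continuous_twoPoint (hV : Continuous V) (hW : Continuous W) (e : ℝ) :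
    Continuous fun z : ℝ × (Coord k → ℝ) => twoPoint V W e z.1 z.2 := by
  have hβ := continuous_halfSphere (k := k)
  have hL := PiLp.continuous_toLp 2 fun _ : Fin (k + 2) => ℝ
  unfold twoPoint pencil
  fun_prop

lemma continuous_twoPoint_right (hV : Continuous V) (hW : Continuous W) (e r : ℝ) :
    Continuous fun x : Coord k → ℝ => twoPoint V W e r x := by
  have hβ := continuous_halfSphere (k := k)
  have hL := PiLp.continuous_toLp 2 fun _ : Fin (k + 2) => ℝ
  unfold twoPoint pencil
  fun_prop

lemma twoPoint_ne_zero
    (h : ∀ (a b c : ℝ) x, a • V x + b • W x + c • x = 0 → x = 0 ∨ (a = 0 ∧ b = 0 ∧ c = 0))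
    {r : ℝ} (hr : r ≠ 0) (x : Coord k → ℝ) (h1 : twoPoint V W 1 r x = 0) :
    twoPoint V W (-1) r x ≠ 0 := by
  intro h2
  unfold twoPoint at h1 h2
  set p : EuclideanSpace ℝ (Fin (k + 2)) := WithLp.toLp 2 fun w => x (.inr w)
  set β := halfSphere fun v => x (.inl (.inr v))
  set A := pencil V W (fun u => x (.inl (.inl u))) (p + r • β) with hA
  set B := pencil V W (fun u => x (.inl (.inl u))) (p - r • β) with hB
  have h3 : (2 : ℝ) • A = 0 := by
    rw [two_smul]
    calc A + A = (A + (1 : ℝ) • B) + (A + (-1 : ℝ) • B) := by module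
      _ = 0 := by rw [h1, h2, add_zero]
  have hA0 : A = 0 := by simpa using h3
  have hB0 : B = 0 := by simpa [hA0] using h1
  have h4 := pencil_eq_zero h hA0
  have h5 := pencil_eq_zero h hB0
  have h6 : (2 * r) • β = 0 := by
    calc (2 * r) • β = (p + r • β) - (p - r • β) := by module
      _ = 0 := by rw [h4, h5, sub_zero]
  have : β ≠ 0 := halfSphere_ne_zero _
  simp [hr, this] at h6

lemma twoPoint_zero_ne_zero
    (h : ∀ (a b c : ℝ) x, a • V x + b • W x + c • x = 0 → x = 0 ∨ (a = 0 ∧ b = 0 ∧ c = 0))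
    {x : Coord k → ℝ} {w : Fin (k + 2)} (hw : x (.inr w) ≠ 0) : twoPoint V W 1 0 x ≠ 0 := by
  intro h1
  unfold twoPoint at h1
  rw [zero_smul, add_zero, sub_zero, one_smul, ← two_smul ℝ, smul_eq_zero] at h1
  have := pencil_eq_zero h (h1.resolve_left two_ne_zero)
  exact hw (by simpa using congrArg (fun z => z w) this)

lemma twoPoint_center (r : ℝ) {x : Coord k → ℝ} (hx : ∀ u, x (.inl (.inl u)) = 0)
    (w : Fin (k + 2)) : twoPoint V W 1 r x w = 2 * x (.inr w) := by
  have : ‖fun _ : Fin 2 => (0 : ℝ)‖ = 0 := norm_zero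
  simp [twoPoint, pencil, hx, this]
  ring

lemma twoPoint_neg_left (e r : ℝ) {x y : Coord k → ℝ}
    (h1 : ‖fun u => x (.inl (.inl u))‖ = 1) (hu : ∀ u, y (.inl (.inl u)) = -x (.inl (.inl u)))
    (hv : ∀ v, y (.inl (.inr v)) = x (.inl (.inr v))) (hw : ∀ w, y (.inr w) = x (.inr w)) :
    twoPoint V W e r y = -twoPoint V W e r x := by
  have := pencil_neg V W h1
  simp only [Pi.neg_def] at this
  simp only [twoPoint, hu, hv, hw, this]
  module

lemma twoPoint_neg_right {e : ℝ} (he : e * e = 1) (r : ℝ) {x y : Coord k → ℝ}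
    (h1 : ‖fun v => x (.inl (.inr v))‖ = 1) (hu : ∀ u, y (.inl (.inl u)) = x (.inl (.inl u)))
    (hv : ∀ v, y (.inl (.inr v)) = -x (.inl (.inr v))) (hw : ∀ w, y (.inr w) = x (.inr w)) :
    twoPoint V W e r y = e • twoPoint V W e r x := by
  have := halfSphere_neg h1
  simp only [Pi.neg_def] at this
  simp only [twoPoint, hu, hv, hw, this, smul_add, smul_smul, he, one_smul, smul_neg,
    sub_neg_eq_add, ← sub_eq_add_neg]
  exact add_comm _ _

/-- Two fields which are nowhere dependent, even modulo the radial direction, can only exist in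
dimensions `k + 2` for which the binomial coefficient `(k + 2).choose 2` is even. -/
theorem choose_two_eq_zero_of_fields (hV : Continuous V) (hW : Continuous W)
    (h : ∀ (a b c : ℝ) x, a • V x + b • W x + c • x = 0 → x = 0 ∨ (a = 0 ∧ b = 0 ∧ c = 0)) :
    (((k + 2).choose 2 : ℕ) : ZMod 2) = 0 := by
  set K : Set (Coord k → ℝ) := Metric.closedBall 0 1 with hK
  set L : Set (Coord k → ℝ) := K ∩ {x | ∃ w, |x (.inr w)| = 1} with hL
  have hKc : IsCompact K := isCompact_closedBall 0 1
  have hLc : IsCompact L := by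
    refine hKc.inter_right ?_
    simp only [Set.ofPred_exists]
    exact isClosed_iUnion_of_finite fun w =>
      isClosed_eq (continuous_abs.comp (continuous_apply _)) continuous_const
  obtain ⟨r, hr, hrL⟩ : ∃ r : ℝ, 0 < r ∧ ∀ x ∈ L, twoPoint V W 1 r x ≠ 0 := by
    have hev : ∀ᶠ r in 𝓝 (0 : ℝ), ∀ x ∈ L, twoPoint V W 1 r x ≠ 0 := by
      have hP : ∀ x ∈ L, ∀ᶠ z : ℝ × (Coord k → ℝ) in 𝓝 (0, x), twoPoint V W 1 z.1 z.2 ≠ 0 := by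
        rintro x ⟨-, w, hw⟩
        have hw0 : x (.inr w) ≠ 0 := by intro h0; simp [h0] at hw
        exact (continuous_twoPoint hV hW 1).continuousAt.eventually_ne
          (twoPoint_zero_ne_zero h hw0)
      exact hLc.eventually_forall_of_forall_eventually hP
    obtain ⟨r, h1, h2⟩ :=
      ((hev.filter_mono nhdsWithin_le_nhds).and (self_mem_nhdsWithin (s := Set.Ioi 0))).exists
    exact ⟨r, h2, h1⟩
  have hcont : ∀ e, Continuous fun x => (twoPoint V W e r x).ofLp := fun e =>
    (PiLp.continuous_ofLp 2 _).comp (continuous_twoPoint_right hV hW e r)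
  obtain ⟨M₁, hM₁⟩ := exists_forall_isSmallIn_sign hKc
    (φ := fun x => Sum.elim (twoPoint V W 1 r x) (twoPoint V W (-1) r x))
    (continuous_pi fun j => by
      rcases j with j | j
      · exact (continuous_apply j).comp (hcont 1)
      · exact (continuous_apply j).comp (hcont (-1)))
    (fun x _ h0 => by
      refine twoPoint_ne_zero h hr.ne' x ?_ ?_
      · ext j; exact congrFun h0 (.inl j)
      · ext j; exact congrFun h0 (.inr j))
  obtain ⟨M₂, hM₂⟩ := exists_forall_isSmallIn_sign hLc (φ := fun x => (twoPoint V W 1 r x).ofLp)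
    (hcont 1) (fun x hx h0 => hrL x hx (by ext j; exact congrFun h0 j))
  set m : ℤ := 2 * (M₁ + M₂) + 1 with hm
  have hm1 : 1 ≤ m := by omega
  have hm' : (0 : ℝ) < m := by exact_mod_cast hm1
  have hscale : ∀ x : Coord k → ℤ, (∀ j, |x j| ≤ m) → scale m x ∈ K := by
    intro x hx
    rw [hK, mem_closedBall_zero_iff, pi_norm_le_iff_of_nonneg zero_le_one]
    intro j
    rw [scale, norm_div, Real.norm_eq_abs, Real.norm_eq_abs, abs_of_pos hm', div_le_one hm']
    exact_mod_cast hx j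
  have hscaleL : ∀ (x : Coord k → ℤ) w, (∀ j, |x j| ≤ m) → |x (.inr w)| = m →
      scale m x ∈ L := by
    refine fun x w hx hw => ⟨hscale x hx, w, ?_⟩
    rw [scale, abs_div, abs_of_pos hm', div_eq_one_iff_eq hm'.ne']
    exact_mod_cast hw
  refine choose_two_eq_zero_of_labelling k (m := m) (by omega) hm1
    (fun i x => signOr (twoPoint V W 1 r (scale m x) (Fin.ofNat (k + 2) i))
      (lexSign fun u => x (.inl (.inl u))))
    (fun i x => signOr (twoPoint V W (-1) r (scale m x) (Fin.ofNat (k + 2) i)) (diagSign x))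
    ?_ ?_ ?_ ?_ ?_
  · intro x y hx u hu h1 h2 h3 i
    have hne : x (.inl (.inl u)) ≠ 0 := by intro h0; simp [h0] at hu; omega
    have hs := lexSign_neg (x := fun u => x (.inl (.inl u))) hne
    have ht : ∀ e, twoPoint V W e r (scale m y) = -twoPoint V W e r (scale m x) := fun e =>
      twoPoint_neg_left e r
        (norm_scale_eq_one (x := fun u => x (.inl (.inl u))) hm1 (fun _ => hx _) hu)
        (by simp [scale, h1, neg_div]) (by simp [scale, h2]) (by simp [scale, h3])
    simp only [ht, PiLp.neg_apply, diagSign, h1, h2, hs, add_right_comm _ (1 : ZMod 2),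
      signOr_neg_add_one, and_self]
  · intro x y hx v hv h1 h2 h3 i
    have hne : x (.inl (.inr v)) ≠ 0 := by intro h0; simp [h0] at hv; omega
    have hs := lexSign_neg (x := fun v => x (.inl (.inr v))) hne
    have ht : ∀ e : ℝ, e * e = 1 →
        twoPoint V W e r (scale m y) = e • twoPoint V W e r (scale m x) := fun e he =>
      twoPoint_neg_right he r
        (norm_scale_eq_one (x := fun v => x (.inl (.inr v))) hm1 (fun _ => hx _) hv)
        (by simp [scale, h1]) (by simp [scale, h2, neg_div]) (by simp [scale, h3])
    rw [ht 1 (by norm_num), ht (-1) (by norm_num)]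
    simp only [one_smul, neg_smul, PiLp.neg_apply, diagSign, h1, h2, hs, ← add_assoc,
      signOr_neg_add_one, and_self]
  · intro S hS
    obtain ⟨j, hj⟩ := hM₁ m (by omega) hm1 S hS fun x hx => hscale x (hS.1 x hx)
    rcases j with j | j
    · refine ⟨j, j.isLt, Or.inl fun x hx y hy => ?_⟩
      rcases hj with hj | hj
      · have h1 := hj x hx
        have h2 := hj y hy
        simp only [Sum.elim_inl] at h1 h2
        simp [signOr, h1, h2]
      · have h1 := hj x hx
        have h2 := hj y hy
        simp only [Sum.elim_inl] at h1 h2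
        simp [signOr, h1, h2, h1.not_gt, h2.not_gt]
    · refine ⟨j, j.isLt, Or.inr fun x hx y hy => ?_⟩
      rcases hj with hj | hj
      · have h1 := hj x hx
        have h2 := hj y hy
        simp only [Sum.elim_inr] at h1 h2
        simp [signOr, h1, h2]
      · have h1 := hj x hx
        have h2 := hj y hy
        simp only [Sum.elim_inr] at h1 h2
        simp [signOr, h1, h2, h1.not_gt, h2.not_gt]
  · intro S hS w hw
    obtain ⟨j, hj⟩ := hM₂ m (by omega) hm1 S hS fun x hx => hscaleL x w (hS.1 x hx) (hw x hx)
    refine ⟨j, j.isLt, fun x hx y hy => ?_⟩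
    rcases hj with hj | hj
    · have h1 := hj x hx
      have h2 := hj y hy
      simp [signOr, h1, h2]
    · have h1 := hj x hx
      have h2 := hj y hy
      simp [signOr, h1, h2, h1.not_gt, h2.not_gt]
  · intro x hx i
    have h0 : lexSign (fun u => x (.inl (.inl u))) = 0 := lexSign_zero fun u => hx _
    have h1 := twoPoint_center (V := V) (W := W) r (x := scale m x) (fun u => by simp [scale, hx]) i
    have h2 : 0 < 2 * scale m x (.inr i) ↔ 0 < x (.inr i) := by
      simp [scale, div_pos_iff_of_pos_right hm']
    simp [signOr, h0, h1, ← h2]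

end Pencil

/-- A continuous map on the unit sphere extends to a positively homogeneous continuous map. -/
lemma exists_homogeneous_extension {d : ℕ}
    {v : Metric.sphere (0 : EuclideanSpace ℝ (Fin d)) 1 → EuclideanSpace ℝ (Fin d)}
    (hv : Continuous v) :
    ∃ V : EuclideanSpace ℝ (Fin d) → EuclideanSpace ℝ (Fin d), Continuous V ∧
      ∀ (s : Metric.sphere (0 : EuclideanSpace ℝ (Fin d)) 1) (t : ℝ), 0 < t →
        V (t • (s : EuclideanSpace ℝ (Fin d))) = t • v s := by
  obtain ⟨g, hg⟩ := ContinuousMap.exists_restrict_eq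
    (Metric.isClosed_sphere (x := (0 : EuclideanSpace ℝ (Fin d))) (ε := 1)) ⟨v, hv⟩
  refine ⟨fun x => ‖x‖ • g (‖x‖⁻¹ • x), ?_, fun s t ht => ?_⟩
  · obtain ⟨C, hC⟩ := (isCompact_closedBall (0 : EuclideanSpace ℝ (Fin d))
      1).exists_bound_of_continuousOn g.continuous.continuousOn
    rw [continuous_iff_continuousAt]
    intro x
    by_cases hx : x = 0
    · subst hx
      rw [ContinuousAt, norm_zero, zero_smul]
      refine squeeze_zero_norm (a := fun x => ‖x‖ * C) (fun x => ?_) ?_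
      · rw [norm_smul, norm_norm]
        refine mul_le_mul_of_nonneg_left (hC _ ?_) (norm_nonneg x)
        rw [mem_closedBall_zero_iff, norm_smul, norm_inv, norm_norm]
        exact inv_mul_le_one
      · have : Continuous fun x : EuclideanSpace ℝ (Fin d) => ‖x‖ * C := by fun_prop
        simpa using this.tendsto 0
    · have hx' : ‖x‖ ≠ 0 := norm_ne_zero_iff.mpr hx
      refine continuous_norm.continuousAt.smul (g.continuous.continuousAt.comp ?_)
      exact (continuous_norm.continuousAt.inv₀ hx').smul continuousAt_id
  · have hs : ‖(s : EuclideanSpace ℝ (Fin d))‖ = 1 := by simp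
    have hgs : g s = v s := congrArg (fun φ => φ s) hg
    simp [norm_smul, hs, abs_of_pos ht, smul_smul, inv_mul_cancel₀ ht.ne', hgs]

/-- **Adams' theorem, special case**: the sphere `S^{4n+1} ⊂ ℝ^{4n+2}` does not admit
two continuous tangent vector fields which are linearly independent at every point:
any two continuous tangent fields `v, w` are linearly dependent somewhere. -/
theorem sphere_no_two_independent_fields (n : ℕ)
    (v w : Metric.sphere (0 : EuclideanSpace ℝ (Fin (4 * n + 2))) 1 →
      EuclideanSpace ℝ (Fin (4 * n + 2)))
    (hv : Continuous v) (hw : Continuous w)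
    (hvt : ∀ x, ⟪v x, (x : EuclideanSpace ℝ (Fin (4 * n + 2)))⟫ = 0)
    (hwt : ∀ x, ⟪w x, (x : EuclideanSpace ℝ (Fin (4 * n + 2)))⟫ = 0) :
    ∃ x, (∃ c : ℝ, v x = c • w x) ∨ (∃ c : ℝ, w x = c • v x) := by
  by_contra! hdep
  obtain ⟨V, hV, hVv⟩ := exists_homogeneous_extension hv
  obtain ⟨W, hW, hWw⟩ := exists_homogeneous_extension hw
  have key := choose_two_eq_zero_of_fields (k := 4 * n) hV hW (by
    intro a b c x h
    by_cases hx : x = 0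
    · exact Or.inl hx
    right
    have hx' : 0 < ‖x‖ := norm_pos_iff.mpr hx
    set s : Metric.sphere (0 : EuclideanSpace ℝ (Fin (4 * n + 2))) 1 :=
      ⟨‖x‖⁻¹ • x, by simp [norm_smul, hx]⟩ with hs
    have hxs : x = ‖x‖ • (s : EuclideanSpace ℝ (Fin (4 * n + 2))) := by
      simp [hs, smul_smul, hx]
    rw [hxs, hVv s _ hx', hWw s _ hx', smul_comm a, smul_comm b, smul_comm c, ← smul_add,
      ← smul_add, smul_eq_zero] at h
    have h := h.resolve_left hx'.ne'
    have hss : ⟪(s : EuclideanSpace ℝ (Fin (4 * n + 2))),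
        (s : EuclideanSpace ℝ (Fin (4 * n + 2)))⟫ = (1 : ℝ) := by
      rw [real_inner_self_eq_norm_sq, norm_eq_of_mem_sphere, one_pow]
    have hc : c = 0 := by
      have := congrArg (fun z => ⟪z, (s : EuclideanSpace ℝ (Fin (4 * n + 2)))⟫) h
      simpa [inner_add_left, inner_smul_left, hvt, hwt, hss] using this
    rw [hc, zero_smul, add_zero] at h
    have ha : a = 0 := by
      by_contra ha
      refine (hdep s).1 (-(a⁻¹ * b)) ?_
      calc v s = a⁻¹ • (a • v s + b • w s) - (a⁻¹ * b) • w s := by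
            rw [smul_add, smul_smul, smul_smul, inv_mul_cancel₀ ha]; module
        _ = _ := by rw [h, smul_zero, zero_sub, neg_smul]
    have hb : b = 0 := by
      by_contra hb
      rw [ha, zero_smul, zero_add, smul_eq_zero] at h
      refine (hdep s).2 0 ?_
      rw [h.resolve_left hb, zero_smul]
    exact ⟨ha, hb, hc⟩)
  have hch : (4 * n + 2).choose 2 = 2 * (4 * n ^ 2 + 3 * n) + 1 := by
    rw [Nat.choose_two_right]
    refine Nat.div_eq_of_eq_mul_left two_pos ?_
    rw [show 4 * n + 2 - 1 = 4 * n + 1 by omega]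
    ring
  rw [hch, ZMod.natCast_eq_zero_iff] at key
  omega
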